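/- Let x = (x₁,…,x_d) be uniformly distributed on S^{d-1}(√d) and let b₁,…,b_d be nonnegative integers with B := Σ_{j=1}^d b_j. Then: (I) E[∏_{j=1}^d x_j^{b_j}] ≥ 0, and this expectation is nonzero only if every b_j is even; (II) there is a constant C > 0, independent of d and of the b_j, such that E[∏_{j=1}^d x_j^{b_j}] ≤ (1 + C·B²/√d)·∏_{j=1}^d (2e·b_j)^{2e·b_j}, with the convention 0⁰ = 1. -/

import Mathlib

/-!
Moments of the coordinates of a uniform point on the sphere `S^{d-1}(√d)`
(Lemma "uniformdist_moments").
-/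

open MeasureTheory

noncomputable section

/-- Uniform probability measure on the sphere of radius `r` in `ℝ^d`
(normalized `(d-1)`-dimensional Hausdorff measure). -/
def sphereUniform (d : ℕ) (r : ℝ) : Measure (EuclideanSpace ℝ (Fin d)) :=
  ((Measure.hausdorffMeasure ((d : ℝ) - 1) :
        Measure (EuclideanSpace ℝ (Fin d))) (Metric.sphere 0 r))⁻¹ •
    (Measure.hausdorffMeasure ((d : ℝ) - 1) :
        Measure (EuclideanSpace ℝ (Fin d))).restrict (Metric.sphere 0 r)

section SphereUniform

variable {d : ℕ}

lemma sphereUniform_univ_le_one (r : ℝ) : sphereUniform d r Set.univ ≤ 1 := by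
  simp [sphereUniform, ENNReal.inv_mul_le_one]

instance (r : ℝ) : IsFiniteMeasure (sphereUniform d r) :=
  ⟨(sphereUniform_univ_le_one r).trans_lt ENNReal.one_lt_top⟩

lemma ae_mem_sphere_sphereUniform (r : ℝ) :
    ∀ᵐ x ∂sphereUniform d r, x ∈ Metric.sphere (0 : EuclideanSpace ℝ (Fin d)) r :=
  Measure.ae_smul_measure (ae_restrict_mem Metric.isClosed_sphere.measurableSet) _

lemma measurePreserving_sphereUniform (r : ℝ)
    (L : EuclideanSpace ℝ (Fin d) ≃ₗᵢ[ℝ] EuclideanSpace ℝ (Fin d)) :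
    MeasurePreserving L (sphereUniform d r) (sphereUniform d r) := by
  have h := (L.toIsometryEquiv.measurePreserving_hausdorffMeasure ((d : ℝ) - 1)).restrict_preimage
    (Metric.isClosed_sphere (x := (0 : EuclideanSpace ℝ (Fin d))) (ε := r)).measurableSet
  have hs : L.toIsometryEquiv ⁻¹' Metric.sphere (0 : EuclideanSpace ℝ (Fin d)) r
      = Metric.sphere 0 r := by
    ext x
    simp
  rw [hs] at h
  exact h.smul_measure _

lemma integral_comp_sphereUniform (r : ℝ)
    (L : EuclideanSpace ℝ (Fin d) ≃ₗᵢ[ℝ] EuclideanSpace ℝ (Fin d))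
    (f : EuclideanSpace ℝ (Fin d) → ℝ) :
    ∫ x, f (L x) ∂sphereUniform d r = ∫ x, f x ∂sphereUniform d r :=
  (measurePreserving_sphereUniform r L).integral_comp
    L.toHomeomorph.measurableEmbedding f

lemma integrable_sphereUniform (r : ℝ) {f : EuclideanSpace ℝ (Fin d) → ℝ} (hf : Continuous f) :
    Integrable f (sphereUniform d r) := by
  have h := hf.continuousOn.integrableOn_compact (μ := sphereUniform d r)
    (isCompact_sphere (0 : EuclideanSpace ℝ (Fin d)) r)
  rwa [IntegrableOn, Measure.restrict_eq_self_of_ae_mem (ae_mem_sphere_sphereUniform r)] at h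

lemma hasDerivAt_integral_sphereUniform (r : ℝ) {F F' : ℝ → EuclideanSpace ℝ (Fin d) → ℝ}
    (hF : ∀ t, Continuous (F t)) (hF' : Continuous (Function.uncurry F'))
    (h : ∀ x t, HasDerivAt (F · x) (F' t x) t) (t : ℝ) :
    HasDerivAt (fun s ↦ ∫ x, F s x ∂sphereUniform d r) (∫ x, F' t x ∂sphereUniform d r) t := by
  obtain ⟨C, hC⟩ := ((isCompact_closedBall t 1).prod
    (isCompact_sphere (0 : EuclideanSpace ℝ (Fin d)) r)).exists_bound_of_continuousOn
    hF'.continuousOn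
  refine (hasDerivAt_integral_of_dominated_loc_of_deriv_le (bound := fun _ ↦ C)
    (Metric.closedBall_mem_nhds t one_pos)
    (.of_forall fun s ↦ (hF s).aestronglyMeasurable) (integrable_sphereUniform r (hF t))
    (hF'.comp (Continuous.prodMk_right t)).aestronglyMeasurable ?_ (integrable_const C)
    (.of_forall fun x s _ ↦ h x s)).2
  filter_upwards [ae_mem_sphere_sphereUniform r] with x hx s hs
  exact hC (s, x) ⟨hs, hx⟩

/-- Reflections in the plane of two coordinates: the `φ`-th one reverses the direction
`cos φ • eᵢ + sin φ • eⱼ`. -/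
lemma exists_linearIsometryEquiv_reflecting {i j : Fin d} (hij : i ≠ j) (φ : ℝ) :
    ∃ L : EuclideanSpace ℝ (Fin d) ≃ₗᵢ[ℝ] EuclideanSpace ℝ (Fin d), ∀ x,
      L x i = -(Real.cos (2 * φ) * x i + Real.sin (2 * φ) * x j) ∧
      L x j = Real.cos (2 * φ) * x j - Real.sin (2 * φ) * x i ∧
      ∀ k, k ≠ i → k ≠ j → L x k = x k := by
  set v : EuclideanSpace ℝ (Fin d) :=
    EuclideanSpace.single i (Real.cos φ) + EuclideanSpace.single j (Real.sin φ) with hv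
  have hvi : v i = Real.cos φ := by simp [hv, hij]
  have hvj : v j = Real.sin φ := by simp [hv, hij.symm]
  have hinner : ∀ x, inner ℝ v x = Real.cos φ * x i + Real.sin φ * x j := fun x ↦ by
    simp [hv, inner_add_left, EuclideanSpace.inner_single_left]
  have hnorm : ‖v‖ ^ 2 = 1 := by
    rw [← real_inner_self_eq_norm_sq, hinner, hvi, hvj]
    nlinarith [Real.sin_sq_add_cos_sq φ]
  have hL : ∀ x k, (Submodule.span ℝ {v})ᗮ.reflection x k
      = x k - 2 * (Real.cos φ * x i + Real.sin φ * x j) * v k := fun x k ↦ by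
    rw [Submodule.reflection_orthogonal_apply, Submodule.reflection_singleton_apply]
    simp [hnorm, hinner]
    ring
  refine ⟨(Submodule.span ℝ {v})ᗮ.reflection, fun x ↦ ⟨?_, ?_, fun k hki hkj ↦ ?_⟩⟩
  · rw [hL, hvi, Real.cos_two_mul, Real.sin_two_mul]
    ring
  · rw [hL, hvj, Real.cos_two_mul, Real.sin_two_mul]
    linear_combination (-2 * x j) * Real.sin_sq_add_cos_sq φ
  · rw [hL]
    simp [hv, hki, hkj]

lemma exists_linearIsometryEquiv_negating (i : Fin d) :
    ∃ L : EuclideanSpace ℝ (Fin d) ≃ₗᵢ[ℝ] EuclideanSpace ℝ (Fin d), ∀ x,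
      L x i = -x i ∧ ∀ k, k ≠ i → L x k = x k := by
  have hL : ∀ x k, (Submodule.span ℝ {EuclideanSpace.single i (1 : ℝ)})ᗮ.reflection x k
      = x k - 2 * x i * (EuclideanSpace.single i (1 : ℝ) : EuclideanSpace ℝ (Fin d)) k :=
    fun x k ↦ by
    rw [Submodule.reflection_orthogonal_apply, Submodule.reflection_singleton_apply]
    simp [EuclideanSpace.inner_single_left]
  refine ⟨(Submodule.span ℝ {EuclideanSpace.single i (1 : ℝ)})ᗮ.reflection,
    fun x ↦ ⟨?_, fun k hki ↦ ?_⟩⟩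
  · rw [hL]
    simp
    ring
  · rw [hL]
    simp [hki]

lemma continuous_prod_coord_pow (s : Finset (Fin d)) (m : Fin d → ℕ) :
    Continuous fun x : EuclideanSpace ℝ (Fin d) ↦ ∏ k ∈ s, x k ^ m k := by
  fun_prop

lemma integral_prod_pow_eq_zero_of_odd (r : ℝ) (m : Fin d → ℕ) {i : Fin d} (hi : Odd (m i)) :
    ∫ x, ∏ k, x k ^ m k ∂sphereUniform d r = 0 := by
  obtain ⟨L, hL⟩ := exists_linearIsometryEquiv_negating i
  have h := integral_comp_sphereUniform r L fun x ↦ ∏ k, x k ^ m k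
  have hneg : ∀ x, ∏ k, L x k ^ m k = -∏ k, x k ^ m k := fun x ↦ by
    rw [← Finset.mul_prod_erase _ _ (Finset.mem_univ i),
      ← Finset.mul_prod_erase _ _ (Finset.mem_univ i), (hL x).1, hi.neg_pow, neg_mul]
    congr 2
    exact Finset.prod_congr rfl fun k hk ↦ by rw [(hL x).2 k (Finset.ne_of_mem_erase hk)]
  simp only [hneg, integral_neg] at h
  linarith

lemma integral_prod_pow_nonneg (r : ℝ) (m : Fin d → ℕ) :
    0 ≤ ∫ x, ∏ k, x k ^ m k ∂sphereUniform d r := by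
  by_cases h : ∀ i, Even (m i)
  · exact integral_nonneg fun x ↦ Finset.prod_nonneg fun k _ ↦ (h k).pow_nonneg _
  · push Not at h
    obtain ⟨i, hi⟩ := h
    exact (integral_prod_pow_eq_zero_of_odd r m (Nat.not_even_iff_odd.1 hi)).ge

/-- Differentiating the rotation-invariant moment along a rotation in the `(i, j)`-plane. -/
lemma succ_mul_integral_sq_mul_prod_pow (r : ℝ) (m : Fin d → ℕ) (i j : Fin d) :
    (m j + 1) * ∫ x, x i ^ 2 * ∏ k, x k ^ m k ∂sphereUniform d r
      = (m i + 1) * ∫ x, x j ^ 2 * ∏ k, x k ^ m k ∂sphereUniform d r := by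
  rcases eq_or_ne i j with rfl | hij
  · rfl
  set Q : EuclideanSpace ℝ (Fin d) → ℝ :=
    fun x ↦ ∏ k ∈ (Finset.univ.erase i).erase j, x k ^ m k
  have hQc : Continuous Q := continuous_prod_coord_pow _ m
  have hprod : ∀ x : EuclideanSpace ℝ (Fin d),
      ∏ k, x k ^ m k = x i ^ m i * (x j ^ m j * Q x) := fun x ↦ by
    rw [← Finset.mul_prod_erase _ _ (Finset.mem_univ i),
      ← Finset.mul_prod_erase _ _ (Finset.mem_erase.2 ⟨hij.symm, Finset.mem_univ j⟩)]
  set X : ℝ → EuclideanSpace ℝ (Fin d) → ℝ :=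
    fun t x ↦ -(Real.cos (2 * t) * x i + Real.sin (2 * t) * x j) with hX
  set Y : ℝ → EuclideanSpace ℝ (Fin d) → ℝ :=
    fun t x ↦ Real.cos (2 * t) * x j - Real.sin (2 * t) * x i with hY
  have hXd : ∀ x t, HasDerivAt (X · x) (-2 * Y t x) t := fun x t ↦ by
    have h2 : HasDerivAt (fun t : ℝ ↦ 2 * t) 2 t := by simpa using (hasDerivAt_id t).const_mul 2
    refine ((h2.cos.mul_const (x i)).add (h2.sin.mul_const (x j))).neg.congr_deriv ?_
    simp only [hY]
    ring
  have hYd : ∀ x t, HasDerivAt (Y · x) (2 * X t x) t := fun x t ↦ by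
    have h2 : HasDerivAt (fun t : ℝ ↦ 2 * t) 2 t := by simpa using (hasDerivAt_id t).const_mul 2
    refine ((h2.cos.mul_const (x j)).sub (h2.sin.mul_const (x i))).congr_deriv ?_
    simp only [hX]
    ring
  have hder := hasDerivAt_integral_sphereUniform r
    (F := fun t x ↦ X t x ^ (m i + 1) * Y t x ^ (m j + 1) * Q x)
    (F' := fun t x ↦ ((((m i + 1 : ℕ) : ℝ) * X t x ^ m i * (-2 * Y t x)) * Y t x ^ (m j + 1)
      + X t x ^ (m i + 1) * (((m j + 1 : ℕ) : ℝ) * Y t x ^ m j * (2 * X t x))) * Q x)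
    (fun t ↦ by simp only [hX, hY]; fun_prop)
    (by simp only [hX, hY, Function.uncurry_def]; fun_prop)
    (fun x t ↦ (((hXd x t).pow (m i + 1)).mul ((hYd x t).pow (m j + 1))).mul_const (Q x)) 0
  have hconst : ∀ t, ∫ x, X t x ^ (m i + 1) * Y t x ^ (m j + 1) * Q x ∂sphereUniform d r
      = ∫ x, x i ^ (m i + 1) * x j ^ (m j + 1) * Q x ∂sphereUniform d r := fun t ↦ by
    obtain ⟨L, hL⟩ := exists_linearIsometryEquiv_reflecting hij t
    rw [← integral_comp_sphereUniform r L fun x ↦ x i ^ (m i + 1) * x j ^ (m j + 1) * Q x]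
    congr 1 with x
    have hLQ : Q (L x) = Q x := Finset.prod_congr rfl fun k hk ↦ by
      simp only [Finset.mem_erase] at hk
      rw [(hL x).2.2 k hk.2.1 hk.1]
    rw [hLQ, (hL x).1, (hL x).2.1]
  simp only [hconst] at hder
  have hzero := hder.unique (hasDerivAt_const 0 _)
  have hint : ∀ l : Fin d, Integrable (fun x ↦ x l ^ 2 * ∏ k, x k ^ m k) (sphereUniform d r) :=
    fun l ↦ integrable_sphereUniform r (by fun_prop)
  have hcalc : ∀ x, ((((m i + 1 : ℕ) : ℝ) * X 0 x ^ m i * (-2 * Y 0 x)) * Y 0 x ^ (m j + 1)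
      + X 0 x ^ (m i + 1) * (((m j + 1 : ℕ) : ℝ) * Y 0 x ^ m j * (2 * X 0 x))) * Q x
      = (2 * (-1) ^ m i) * ((m j + 1) * (x i ^ 2 * ∏ k, x k ^ m k)
        - (m i + 1) * (x j ^ 2 * ∏ k, x k ^ m k)) := fun x ↦ by
    have hX0 : X 0 x = -x i := by simp [hX]
    have hY0 : Y 0 x = x j := by simp [hY]
    rw [hX0, hY0, hprod, pow_succ (-x i), neg_pow (x i) (m i)]
    push_cast
    ring
  simp only [hcalc] at hzero
  rw [integral_const_mul, integral_sub ((hint i).const_mul _) ((hint j).const_mul _),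
    integral_const_mul, integral_const_mul] at hzero
  have := (mul_eq_zero.1 hzero).resolve_left (by simp)
  linarith

lemma integral_sq_mul_prod_pow (r : ℝ) (m : Fin d → ℕ) (i : Fin d) :
    (d + ∑ k, (m k : ℝ)) * ∫ x, x i ^ 2 * ∏ k, x k ^ m k ∂sphereUniform d r
      = (m i + 1) * (r ^ 2 * ∫ x, ∏ k, x k ^ m k ∂sphereUniform d r) := by
  have hsum : ∑ j, ∫ x, x j ^ 2 * ∏ k, x k ^ m k ∂sphereUniform d r
      = r ^ 2 * ∫ x, ∏ k, x k ^ m k ∂sphereUniform d r := by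
    rw [← integral_finsetSum _ fun j _ ↦ integrable_sphereUniform r (by fun_prop),
      ← integral_const_mul]
    refine integral_congr_ae ?_
    filter_upwards [ae_mem_sphere_sphereUniform r] with x hx
    rw [← Finset.sum_mul, ← EuclideanSpace.real_norm_sq_eq, mem_sphere_zero_iff_norm.1 hx]
  rw [← hsum, Finset.mul_sum, ← Finset.sum_congr rfl fun j _ ↦
    succ_mul_integral_sq_mul_prod_pow r m i j, ← Finset.sum_mul, Finset.sum_add_distrib]
  simp [add_comm]

lemma integral_prod_pow_le_prod_factorial (hd : 1 ≤ d) (b : Fin d → ℕ) :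
    ∫ x, ∏ k, x k ^ b k ∂sphereUniform d (Real.sqrt d) ≤ ∏ k, ((b k).factorial : ℝ) := by
  induction hn : ∑ k, b k using Nat.strong_induction_on generalizing b with
  | _ n ih =>
  by_cases hodd : ∃ i, Odd (b i)
  · obtain ⟨i, hi⟩ := hodd
    rw [integral_prod_pow_eq_zero_of_odd _ b hi]
    positivity
  by_cases hb : ∀ i, b i = 0
  · simpa [hb, Measure.real] using ENNReal.toReal_mono ENNReal.one_ne_top
      (sphereUniform_univ_le_one (d := d) (Real.sqrt d))
  push Not at hodd hb
  obtain ⟨i, hi⟩ := hb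
  obtain ⟨a, ha⟩ : ∃ a, b i = a + 2 := by
    obtain ⟨c, hc⟩ := Nat.not_odd_iff_even.1 (by simpa using hodd i)
    exact ⟨b i - 2, by omega⟩
  set m : Fin d → ℕ := Function.update b i a with hm
  have hmi : m i = a := by simp [hm]
  have hsplit : ∀ x : EuclideanSpace ℝ (Fin d),
      ∏ k, x k ^ b k = x i ^ 2 * ∏ k, x k ^ m k := fun x ↦ by
    rw [← Finset.mul_prod_erase _ _ (Finset.mem_univ i),
      ← Finset.mul_prod_erase _ (fun k ↦ x k ^ m k) (Finset.mem_univ i), hmi, ha, ← mul_assoc,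
      pow_add, mul_comm (x i ^ a)]
    congr 1
    exact Finset.prod_congr rfl fun k hk ↦ by simp [hm, Finset.ne_of_mem_erase hk]
  have hfact : ∏ k, ((b k).factorial : ℝ) = (a + 2) * (a + 1) * ∏ k, ((m k).factorial : ℝ) := by
    rw [← Finset.mul_prod_erase _ _ (Finset.mem_univ i),
      ← Finset.mul_prod_erase _ (fun k ↦ ((m k).factorial : ℝ)) (Finset.mem_univ i), hmi, ha,
      ← mul_assoc, Nat.factorial_succ, Nat.factorial_succ]
    congr 1
    · push_cast
      ring
    · exact Finset.prod_congr rfl fun k hk ↦ by simp [hm, Finset.ne_of_mem_erase hk]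
  have hlt : ∑ k, m k < n := by
    rw [← hn]
    refine Finset.sum_lt_sum (fun k _ ↦ ?_) ⟨i, Finset.mem_univ i, by omega⟩
    rcases eq_or_ne k i with rfl | hk
    · omega
    · simp [hm, hk]
  have hrec := integral_sq_mul_prod_pow (Real.sqrt d) m i
  rw [Real.sq_sqrt (Nat.cast_nonneg d), hmi] at hrec
  have hM := ih _ hlt m rfl
  have hN := integral_prod_pow_nonneg (Real.sqrt d) b
  simp only [hsplit] at hN ⊢
  have hd' : (0 : ℝ) < d := by exact_mod_cast hd
  have hle : ∫ x, x i ^ 2 * ∏ k, x k ^ m k ∂sphereUniform d (Real.sqrt d)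
      ≤ (a + 1) * ∫ x, ∏ k, x k ^ m k ∂sphereUniform d (Real.sqrt d) := by
    refine le_of_mul_le_mul_left ?_ hd'
    have hs : 0 ≤ (∑ k, (m k : ℝ)) *
        ∫ x, x i ^ 2 * ∏ k, x k ^ m k ∂sphereUniform d (Real.sqrt d) := by positivity
    linarith
  rw [hfact]
  calc _ ≤ (a + 1) * ∫ x, ∏ k, x k ^ m k ∂sphereUniform d (Real.sqrt d) := hle
    _ ≤ (a + 1) * ∏ k, ((m k).factorial : ℝ) := by gcongr
    _ ≤ (a + 2) * (a + 1) * ∏ k, ((m k).factorial : ℝ) := by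
      gcongr
      exact le_mul_of_one_le_left (by positivity) (by linarith [(Nat.cast_nonneg a : (0 : ℝ) ≤ a)])

end SphereUniform

lemma factorial_le_two_exp_mul_rpow (n : ℕ) :
    (n.factorial : ℝ) ≤ (2 * Real.exp 1 * n) ^ (2 * Real.exp 1 * n) := by
  rcases n.eq_zero_or_pos with rfl | hn
  · simp
  have hn' : (1 : ℝ) ≤ n := by exact_mod_cast hn
  have hle : (n : ℝ) ≤ 2 * Real.exp 1 * n :=
    le_mul_of_one_le_left (by positivity) (by linarith [Real.add_one_le_exp 1])
  calc (n.factorial : ℝ) ≤ (n : ℝ) ^ n := by exact_mod_cast Nat.factorial_le_pow n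
    _ = (n : ℝ) ^ (n : ℝ) := (Real.rpow_natCast _ _).symm
    _ ≤ (2 * Real.exp 1 * n) ^ (n : ℝ) := by gcongr
    _ ≤ _ := Real.rpow_le_rpow_of_exponent_le (hn'.trans hle) hle

/-- Let `x` be uniform on `S^{d-1}(√d)` and `b₁, …, b_d` nonnegative integers,
`B = ∑ⱼ bⱼ`.  Then (I) `E[∏ⱼ xⱼ^{bⱼ}] ≥ 0`, with the expectation nonzero only if each `bⱼ`
is even; and (II) there is a constant `C > 0`, independent of `d` and of the `bⱼ`, with
`E[∏ⱼ xⱼ^{bⱼ}] ≤ (1 + C B²/√d) ∏ⱼ (2e bⱼ)^{2e bⱼ}` (with the convention `0⁰ = 1`,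
which is the convention of `Real.rpow`). -/
theorem sphere_moment_nonneg_even_and_upper_bound :
    (∀ d : ℕ, 1 ≤ d → ∀ b : Fin d → ℕ,
      0 ≤ (∫ x, ∏ j, x j ^ b j ∂sphereUniform d (Real.sqrt d)) ∧
      ((∫ x, ∏ j, x j ^ b j ∂sphereUniform d (Real.sqrt d)) ≠ 0 → ∀ j, Even (b j))) ∧
    (∃ C : ℝ, 0 < C ∧ ∀ d : ℕ, 1 ≤ d → ∀ b : Fin d → ℕ,
      (∫ x, ∏ j, x j ^ b j ∂sphereUniform d (Real.sqrt d)) ≤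
        (1 + C * (∑ j, (b j : ℝ)) ^ 2 / Real.sqrt d) *
          ∏ j, (2 * Real.exp 1 * (b j : ℝ)) ^ (2 * Real.exp 1 * (b j : ℝ))) := by
  refine ⟨fun d _ b ↦ ⟨integral_prod_pow_nonneg _ b, fun h j ↦ ?_⟩, 1, one_pos, fun d hd b ↦ ?_⟩
  · by_contra hj
    exact h (integral_prod_pow_eq_zero_of_odd _ b (Nat.not_even_iff_odd.1 hj))
  · refine (integral_prod_pow_le_prod_factorial hd b).trans ?_
    refine (Finset.prod_le_prod (fun _ _ ↦ by positivity) fun j _ ↦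
      factorial_le_two_exp_mul_rpow (b j)).trans ?_
    exact le_mul_of_one_le_left (by positivity) (le_add_of_nonneg_right (by positivity))

end
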